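/- For every n ≥ 1, there do not exist quaternions x₁, …, xₙ, y ∈ ℍ such that Σ_{m=1}^{n} x_m·i·(star x_m) − y·i·(star y) = 0 and Σ_{m=1}^{n} ‖x_m‖² − ‖y‖² = −1, where i denotes the quaternion unit i. -/

import Mathlib

open Matrix BigOperators

noncomputable section

abbrev Hq : Type := Quaternion ℝ

def qi : Hq := ⟨0, 1, 0, 0⟩
def qj : Hq := ⟨0, 0, 1, 0⟩
def qk : Hq := ⟨0, 0, 0, 1⟩

/-- A quaternion is real if all its imaginary parts vanish. -/
def isRealQ (q : Hq) : Prop := q.imI = 0 ∧ q.imJ = 0 ∧ q.imK = 0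

/-- The matrix `J_{n,1}` with diagonal `(1,…,1,−1)`. -/
def Jq (n : ℕ) : Matrix (Fin (n+1)) (Fin (n+1)) Hq :=
  Matrix.diagonal fun i => if i = Fin.last n then -1 else 1

/-- `Sp(n,1)` as a set of `(n+1)×(n+1)` quaternionic matrices. -/
def Sp (n : ℕ) : Set (Matrix (Fin (n+1)) (Fin (n+1)) Hq) :=
  {g | gᴴ * Jq n * g = Jq n}

/-- The complex matrix `J_{m,1}`. -/
def Jc (m : ℕ) : Matrix (Fin (m+1)) (Fin (m+1)) ℂ :=
  Matrix.diagonal fun i => if i = Fin.last m then -1 else 1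

/-- `SU(m,1)` as a set of `(m+1)×(m+1)` complex matrices. -/
def SU (m : ℕ) : Set (Matrix (Fin (m+1)) (Fin (m+1)) ℂ) :=
  {A | Aᴴ * Jc m * A = Jc m ∧ A.det = 1}

/-- The ℝ-algebra embedding `ℂ → ℍ`, `a + b√(−1) ↦ a + b i`. -/
def ι (z : ℂ) : Hq := ⟨z.re, z.im, 0, 0⟩


/-- there are no quaternions `x₁,…,xₙ,y` with
`Σ xₘ i x̄ₘ − y i ȳ = 0` and `Σ ‖xₘ‖² − ‖y‖² = −1`. -/
theorem stmt8 (n : ℕ) (hn : 1 ≤ n) :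
    ¬ ∃ (x : Fin n → Hq) (y : Hq),
      (∑ m, x m * qi * star (x m)) - y * qi * star y = 0 ∧
      (∑ m, ‖x m‖ ^ 2) - ‖y‖ ^ 2 = -1 := by
  rintro ⟨x, y, h, hnorm⟩
  have hqi : ‖qi‖ = 1 := by
    rw [← sq_eq_sq₀ (norm_nonneg _) zero_le_one, sq, ← Quaternion.normSq_eq_norm_mul_self,
      Quaternion.normSq_def']
    simp [qi]
  have norm_conj (q : Hq) : ‖q * qi * star q‖ = ‖q‖ ^ 2 := by
    rw [norm_mul, norm_mul, hqi, norm_star, mul_one, sq]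
  have hle : ‖y‖ ^ 2 ≤ ∑ m, ‖x m‖ ^ 2 := by
    rw [← norm_conj y, ← sub_eq_zero.mp h]
    exact (norm_sum_le _ _).trans_eq (Finset.sum_congr rfl fun m _ => norm_conj (x m))
  linarith
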